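/- For every n ≥ 2, there exists a strongly connected properly incomplete partial DFA with n states whose reset threshold equals (n² − n)/2. -/

import Mathlib

open scoped Classical

section Defs

variable {Q A : Type*}

/-- Action of a word in a partial DFA with transition function `δ`
(`none` means the undefined value ⊥). -/
def stepWord (δ : Q → A → Option Q) : Q → List A → Option Q
  | q, [] => some q
  | q, a :: w => (δ q a).bind (fun p => stepWord δ p w)

/-- The image `δ(S, w)` of a set of states under the action of a word. -/
def img (δ : Q → A → Option Q) (S : Set Q) (w : List A) : Set Q :=
  {p | ∃ q ∈ S, stepWord δ q w = some p}

/-- The inseparability equivalence `p ≡ q`. -/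
def Insep (δ : Q → A → Option Q) (p q : Q) : Prop :=
  ∀ u : List A, (stepWord δ p u).isSome ↔ (stepWord δ q u).isSome

/-- `κ(S)`: the number of inseparability classes intersecting `S`. -/
noncomputable def kappa (δ : Q → A → Option Q) (S : Set Q) : ℕ :=
  {C : Set Q | ∃ p ∈ S, C = {q | Insep δ p q}}.ncard

def StronglyConnected (δ : Q → A → Option Q) : Prop :=
  ∀ p q : Q, ∃ w : List A, stepWord δ p w = some q

/-- The transition function of the fixing automaton `A^F`. -/
def fixDelta (δ : Q → A → Option Q) (q : Q) (a : A) : Q := (δ q a).getD q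

/-- Action of a word in a complete DFA. -/
def stepWordC (δc : Q → A → Q) (q : Q) (w : List A) : Q := w.foldl δc q

/-- The image of a set of states under the action of a word in a complete DFA. -/
def imgC (δc : Q → A → Q) (S : Set Q) (w : List A) : Set Q :=
  (fun q => stepWordC δc q w) '' S

end Defs

section Words

variable {Q A : Type*}

theorem stepWord_append (δ : Q → A → Option Q) (q : Q) (u v : List A) :
    stepWord δ q (u ++ v) = (stepWord δ q u).bind fun p => stepWord δ p v := by
  induction u generalizing q with
  | nil => rfl
  | cons a u ih =>
    simp only [List.cons_append, stepWord]
    cases δ q a <;> simp [ih]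

theorem img_append (δ : Q → A → Option Q) (S : Set Q) (u v : List A) :
    img δ S (u ++ v) = img δ (img δ S u) v := by
  ext p
  simp only [img, stepWord_append, Option.bind_eq_some_iff, Set.mem_ofPred_eq]
  grind

/-- If every letter acts injectively where it is defined, so does every word. -/
theorem stepWord_injective {δ : Q → A → Option Q}
    (hδ : ∀ p q a r, δ p a = some r → δ q a = some r → p = q) {p q r : Q} {w : List A}
    (hp : stepWord δ p w = some r) (hq : stepWord δ q w = some r) : p = q := by
  induction w generalizing p q with
  | nil => simp_all [stepWord]
  | cons a w ih =>
    simp only [stepWord, Option.bind_eq_some_iff] at hp hq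
    obtain ⟨p', hp', hp⟩ := hp
    obtain ⟨q', hq', hq⟩ := hq
    obtain rfl := ih hp hq
    exact hδ _ _ _ _ hp' hq'

end Words

/-- The letter `0` is undefined at the state `0` and fixes all other states; every other letter
`a` transposes the states `a - 1` and `a`. -/
def transpositionDelta {n : ℕ} (q a : Fin n) : Option (Fin n) :=
  if a.val = 0 then if q.val = 0 then none else some q
  else if q = a then some ⟨a.val - 1, by omega⟩
  else if q.val + 1 = a.val then some a
  else some q

section Transposition

variable {n : ℕ}

theorem transpositionDelta_injective (p q a r : Fin n)
    (hp : transpositionDelta p a = some r) (hq : transpositionDelta q a = some r) : p = q := by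
  simp only [transpositionDelta, Fin.ext_iff] at hp hq ⊢
  split_ifs at hp hq <;> simp only [Option.some.injEq, Fin.ext_iff] at hp hq <;> omega

theorem exists_stepWord_zero (k : ℕ) (hk : k < n) :
    (∃ w, stepWord transpositionDelta (⟨k, hk⟩ : Fin n) w = some ⟨0, by omega⟩) ∧
      ∃ w, stepWord transpositionDelta (⟨0, by omega⟩ : Fin n) w = some ⟨k, hk⟩ := by
  induction k with
  | zero => exact ⟨⟨[], rfl⟩, ⟨[], rfl⟩⟩
  | succ k ih =>
    obtain ⟨⟨u, hu⟩, ⟨v, hv⟩⟩ := ih (by omega)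
    refine ⟨⟨⟨k + 1, hk⟩ :: u, ?_⟩, ⟨v ++ [⟨k + 1, hk⟩], ?_⟩⟩
    · simpa [stepWord, transpositionDelta] using hu
    · simp [stepWord_append, hv, stepWord, transpositionDelta]

theorem stronglyConnected_transpositionDelta :
    StronglyConnected (transpositionDelta (n := n)) := by
  intro p q
  obtain ⟨u, hu⟩ := (exists_stepWord_zero p.val p.isLt).1
  obtain ⟨v, hv⟩ := (exists_stepWord_zero q.val q.isLt).2
  exact ⟨u ++ v, by simp [stepWord_append, hu, hv]⟩

/-- The word `k, k - 1, …, 0`. -/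
def descendingWord (n : ℕ) [NeZero n] : ℕ → List (Fin n)
  | 0 => [Fin.ofNat n 0]
  | k + 1 => Fin.ofNat n (k + 1) :: descendingWord n k

/-- The concatenation of the words `j, j - 1, …, 0` for `j = 0, …, k - 1`. -/
def erasingWord (n : ℕ) [NeZero n] : ℕ → List (Fin n)
  | 0 => []
  | k + 1 => erasingWord n k ++ descendingWord n k

theorem length_descendingWord [NeZero n] (k : ℕ) : (descendingWord n k).length = k + 1 := by
  induction k with
  | zero => rfl
  | succ k ih => simp [descendingWord, ih]

theorem length_erasingWord [NeZero n] (k : ℕ) :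
    (erasingWord n k).length = ∑ i ∈ Finset.range k, (i + 1) := by
  induction k with
  | zero => rfl
  | succ k ih => simp [erasingWord, ih, Finset.sum_range_succ, length_descendingWord]

theorem stepWord_descendingWord_self [NeZero n] (k : ℕ) (hk : k < n) :
    stepWord transpositionDelta (⟨k, hk⟩ : Fin n) (descendingWord n k) = none := by
  induction k with
  | zero => simp [descendingWord, stepWord, transpositionDelta]
  | succ k ih =>
    have h : Fin.ofNat n (k + 1) = ⟨k + 1, hk⟩ := by
      simp [Fin.ext_iff, Nat.mod_eq_of_lt hk]
    rw [descendingWord, h]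
    simpa [stepWord, transpositionDelta] using ih (by omega)

theorem stepWord_descendingWord_of_lt [NeZero n] (k : ℕ) (q : Fin n) (hk : k < q.val) :
    stepWord transpositionDelta q (descendingWord n k) = some q := by
  induction k with
  | zero =>
    have h : q ≠ 0 := Fin.pos_iff_ne_zero.1 hk
    simp [descendingWord, stepWord, transpositionDelta, h]
  | succ k ih =>
    have h : Fin.ofNat n (k + 1) = ⟨k + 1, by omega⟩ := by
      simp [Fin.ext_iff, Nat.mod_eq_of_lt (show k + 1 < n by omega)]
    have hq : transpositionDelta q (Fin.ofNat n (k + 1)) = some q := by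
      rw [h]
      simp only [transpositionDelta, Fin.ext_iff]
      split_ifs <;> first | rfl | omega
    rw [descendingWord, stepWord, hq, Option.bind_some, ih (by omega)]

theorem img_erasingWord [NeZero n] (k : ℕ) (hk : k < n) :
    img transpositionDelta Set.univ (erasingWord n k) = {q : Fin n | k ≤ q.val} := by
  induction k with
  | zero => ext; simp [img, erasingWord, stepWord]
  | succ k ih =>
    rw [erasingWord, img_append, ih (by omega)]
    ext p
    simp only [img, Set.mem_ofPred_eq]
    constructor
    · rintro ⟨q, hq, hp⟩
      rcases hq.eq_or_lt with h | h
      · subst h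
        exact absurd ((stepWord_descendingWord_self _ q.isLt).symm.trans hp) (by simp)
      · rw [stepWord_descendingWord_of_lt _ _ h, Option.some.injEq] at hp
        exact hp ▸ h
    · intro hp
      exact ⟨p, by omega, stepWord_descendingWord_of_lt _ _ hp⟩

theorem ncard_img_erasingWord [NeZero n] :
    (img transpositionDelta Set.univ (erasingWord n (n - 1))).ncard = 1 := by
  have hn : 0 < n := NeZero.pos n
  rw [img_erasingWord _ (by omega), Set.ncard_eq_one]
  refine ⟨⟨n - 1, by omega⟩, ?_⟩
  ext q
  simp only [Set.mem_ofPred_eq, Set.mem_singleton_iff, Fin.ext_iff]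
  omega

/-- The weight of a state is its distance to being erased; `⊥` has weight `0`. -/
def stateWeight (o : Option (Fin n)) : ℕ := o.elim 0 fun q => q.val + 1

theorem stateWeight_le_bind_add (o : Option (Fin n)) (a : Fin n) :
    stateWeight o ≤ stateWeight (o.bind fun q => stepWord transpositionDelta q [a]) +
      if o = some a then 1 else 0 := by
  rcases o with _ | q
  · simp [stateWeight]
  · simp only [stepWord, Option.bind_some, transpositionDelta, Option.some.injEq, Fin.ext_iff]
    split_ifs <;> simp [stateWeight] <;> omega

theorem sum_weight_le_add_length (w : List (Fin n)) :
    ∑ q : Fin n, (q.val + 1) ≤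
      ∑ q : Fin n, stateWeight (stepWord transpositionDelta q w) + w.length := by
  induction w using List.reverseRecOn with
  | nil => simp [stepWord, stateWeight]
  | append_singleton w a ih =>
    have hone : ∑ q : Fin n, (if stepWord transpositionDelta q w = some a then 1 else 0) ≤ 1 := by
      rw [← Finset.card_filter, Finset.card_le_one]
      intro p hp q hq
      exact stepWord_injective transpositionDelta_injective
        (Finset.mem_filter.1 hp).2 (Finset.mem_filter.1 hq).2
    have hstep := Finset.sum_le_sum fun q (_ : q ∈ Finset.univ) =>
      stateWeight_le_bind_add (stepWord transpositionDelta q w) a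
    rw [Finset.sum_add_distrib] at hstep
    simp only [stepWord_append, List.length_append, List.length_singleton]
    omega

theorem sum_stateWeight_le {w : List (Fin n)}
    (hw : (img transpositionDelta Set.univ w).ncard = 1) :
    ∑ q : Fin n, stateWeight (stepWord transpositionDelta q w) ≤ n := by
  obtain ⟨r, hr⟩ := Set.ncard_eq_one.1 hw
  obtain ⟨p, -, hp⟩ : r ∈ img transpositionDelta Set.univ w := hr ▸ rfl
  rw [Finset.sum_eq_single p]
  · simp only [hp, stateWeight, Option.elim_some]
    omega
  · intro q _ hqp
    cases hq : stepWord transpositionDelta q w with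
    | none => rfl
    | some s =>
      have hs : s ∈ img transpositionDelta Set.univ w := ⟨q, trivial, hq⟩
      rw [hr, Set.mem_singleton_iff] at hs
      subst hs
      exact absurd (stepWord_injective transpositionDelta_injective hq hp) hqp
  · simp

theorem sum_range_pred_succ (n : ℕ) :
    ∑ i ∈ Finset.range (n - 1), (i + 1) = (n ^ 2 - n) / 2 := by
  rw [sq, ← Nat.mul_sub_one, ← Finset.sum_range_id]
  cases n with
  | zero => rfl
  | succ n => simp [Finset.sum_range_succ']

theorem le_length_of_ncard_img_eq_one {w : List (Fin n)}
    (hw : (img transpositionDelta Set.univ w).ncard = 1) : (n ^ 2 - n) / 2 ≤ w.length := by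
  have h := (sum_weight_le_add_length w).trans (Nat.add_le_add_right (sum_stateWeight_le hw) _)
  rw [Fin.sum_univ_eq_sum_range (fun i => i + 1), Finset.sum_add_distrib, Finset.sum_range_id] at h
  rw [sq, ← Nat.mul_sub_one]
  simp at h
  omega

end Transposition

/-- for every `n ≥ 2` there is a strongly connected, properly incomplete
partial DFA with `n` states (over some finite alphabet `Fin m`) that is synchronizing and
whose reset threshold equals `(n² − n)/2`. -/
theorem stmt18 (n : ℕ) (hn : 2 ≤ n) :
    ∃ (m : ℕ) (δ : Fin n → Fin m → Option (Fin n)),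
      StronglyConnected δ ∧
      (∃ a : Fin m, (∃ q, (δ q a).isSome) ∧ (∃ q, δ q a = none)) ∧
      (∃ w : List (Fin m), (img δ Set.univ w).ncard = 1) ∧
      sInf {k : ℕ | ∃ w : List (Fin m), w.length = k ∧ (img δ Set.univ w).ncard = 1} =
        (n ^ 2 - n) / 2 := by
  have : NeZero n := ⟨by omega⟩
  refine ⟨n, transpositionDelta, stronglyConnected_transpositionDelta,
    ⟨⟨0, by omega⟩, ⟨⟨1, by omega⟩, ?_⟩, ⟨⟨0, by omega⟩, ?_⟩⟩,
    ⟨_, ncard_img_erasingWord⟩, le_antisymm ?_ ?_⟩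
  · simp [transpositionDelta]
  · simp [transpositionDelta]
  · exact Nat.sInf_le ⟨_, (length_erasingWord _).trans (sum_range_pred_succ n),
      ncard_img_erasingWord⟩
  · refine le_csInf ⟨_, _, rfl, ncard_img_erasingWord⟩ ?_
    rintro _ ⟨w, rfl, hw⟩
    exact le_length_of_ncard_img_eq_one hw
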